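/- arXiv:2112.10069 — 4 statements merged into one kernel-verified Lean document; each statement's English description precedes it below -/
import Mathlib

section
/- Let A = (a_{ij}) be an n×n Cartan matrix, let 1 ≤ m < n, set I = {1,…,m} and J = {m+1,…,n}, and write A_I = (a_{kl})_{k,l∈I} (itself an m×m Cartan matrix) and A_{JI} = (a_{jl})_{j∈J, l∈I}. Suppose C is an (n−m)×m rational matrix with C A_I = A_{JI}, and let M = [[I_m, 0],[C, I_{n−m}]]. Then for every i ∈ I, M⁻¹ S_i M is the block-diagonal matrix diag(S_i^{(A_I)}, I_{n−m}), where S_i^{(A_I)} = I_m − (A_I e_i) e_i^T is the i-th Weyl reflection matrix of the Cartan matrix A_I. Consequently, conjugation by M carries the linear action of W_I(A) on ℚ^n to the direct sum of the weight action of W(A_I) on ℚ^m and the trivial action on ℚ^{n−m}. -/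
def IsCartanMatrix {ι : Type*} (A : Matrix ι ι ℤ) : Prop :=
  (∀ i, A i i = 2) ∧ (∀ i j, i ≠ j → A i j ≤ 0) ∧ (∀ i j, A i j = 0 → A j i = 0)

/-- The matrix `S_i = I - (A e_i) eᵢᵀ` of the `i`-th Weyl reflection. -/
def weylMatrix {ι : Type*} [DecidableEq ι] (A : Matrix ι ι ℤ) (i : ι) : Matrix ι ι ℚ :=
  1 - Matrix.of (fun k l => if l = i then (A k i : ℚ) else 0)

/-- `W_I(A)`, the subgroup of `GL_n(ℚ)` generated by the Weyl reflections `σ_i`, `i ∈ I`. -/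
def weylGroup {ι : Type*} [Fintype ι] [DecidableEq ι] (A : Matrix ι ι ℤ) (I : Set ι) :
    Subgroup (GL ι ℚ) :=
  Subgroup.closure {g : GL ι ℚ | ∃ i ∈ I, (g : Matrix ι ι ℚ) = weylMatrix A i}

open Matrix in
theorem fromBlocks_one_zero_isUnit_det {m n R : Type*} [Fintype m] [DecidableEq m] [Fintype n]
    [DecidableEq n] [CommRing R] (C : Matrix n m R) :
    IsUnit (fromBlocks (1 : Matrix m m R) 0 C (1 : Matrix n n R)).det := by
  simp

open Matrix in
/-- The intertwining relation `S_i M = M diag(S_i^{(A_I)}, 1)`. -/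
theorem weylMatrix_inl_mul_fromBlocks {ι κ : Type*} [Fintype ι] [DecidableEq ι] [Fintype κ]
    [DecidableEq κ] (A : Matrix (ι ⊕ κ) (ι ⊕ κ) ℤ) (C : Matrix κ ι ℚ)
    (hC : C * (A.map (fun z => (z : ℚ))).toBlocks₁₁ = (A.map (fun z => (z : ℚ))).toBlocks₂₁)
    (i : ι) :
    weylMatrix A (Sum.inl i) * fromBlocks 1 0 C 1 =
      fromBlocks 1 0 C 1 * fromBlocks (weylMatrix A.toBlocks₁₁ i) 0 0 1 := by
  set X : Matrix κ ι ℚ := of fun k l => if l = i then (A (Sum.inr k) (Sum.inl i) : ℚ) else 0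
    with hX
  have hS : weylMatrix A (Sum.inl i) = fromBlocks (weylMatrix A.toBlocks₁₁ i) 0 (-X) 1 := by
    ext (a | a) (b | b) <;> simp [weylMatrix, hX, one_apply, toBlocks₁₁]
  have hCX : C * weylMatrix A.toBlocks₁₁ i = C - X := by
    rw [weylMatrix, Matrix.mul_sub, Matrix.mul_one]
    congr 1
    ext a b
    have h := congrFun (congrFun hC a) i
    by_cases hb : b = i
    · simpa [hX, hb, mul_apply, toBlocks₁₁, toBlocks₂₁] using h
    · simp [hX, hb, mul_apply]
  rw [hS, fromBlocks_multiply, fromBlocks_multiply]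
  simp [hCX, sub_eq_add_neg, add_comm]

open Matrix in
/-- Every element of `W_I(A)` is intertwined by `M` with `diag(h, 1)` for some `h ∈ W(A_I)`. -/
theorem exists_weylGroup_mul_fromBlocks {ι κ : Type*} [Fintype ι] [DecidableEq ι] [Fintype κ]
    [DecidableEq κ] (A : Matrix (ι ⊕ κ) (ι ⊕ κ) ℤ) (C : Matrix κ ι ℚ)
    (hC : C * (A.map (fun z => (z : ℚ))).toBlocks₁₁ = (A.map (fun z => (z : ℚ))).toBlocks₂₁)
    {g : GL (ι ⊕ κ) ℚ} (hg : g ∈ weylGroup A (Set.range Sum.inl)) :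
    ∃ h ∈ weylGroup A.toBlocks₁₁ (Set.univ : Set ι),
      (g : Matrix (ι ⊕ κ) (ι ⊕ κ) ℚ) * fromBlocks 1 0 C 1 =
        fromBlocks 1 0 C 1 * fromBlocks (h : Matrix ι ι ℚ) 0 0 1 := by
  induction hg using Subgroup.closure_induction with
  | mem g hg =>
    obtain ⟨_, ⟨i, rfl⟩, hgi⟩ := hg
    have hrel := weylMatrix_inl_mul_fromBlocks A C hC i
    rw [← hgi] at hrel
    have hunit : IsUnit (weylMatrix A.toBlocks₁₁ i) := by
      rw [isUnit_iff_isUnit_det]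
      have hdet := congrArg det hrel
      simp only [det_mul, det_fromBlocks_zero₁₂, det_one, mul_one, one_mul] at hdet
      rw [← hdet]
      exact (isUnit_iff_isUnit_det _).mp g.isUnit
    obtain ⟨u, hu⟩ := hunit
    exact ⟨u, Subgroup.subset_closure ⟨i, Set.mem_univ i, hu⟩, by rw [hu]; exact hrel⟩
  | one => exact ⟨1, one_mem _, by simp⟩
  | mul x y _ _ hx hy =>
    obtain ⟨a, ha, hxa⟩ := hx
    obtain ⟨b, hb, hyb⟩ := hy
    refine ⟨a * b, mul_mem ha hb, ?_⟩
    have hab : fromBlocks ((a * b : GL ι ℚ) : Matrix ι ι ℚ) 0 0 (1 : Matrix κ κ ℚ) =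
        fromBlocks (a : Matrix ι ι ℚ) 0 0 1 * fromBlocks (b : Matrix ι ι ℚ) 0 0 1 := by
      simp [fromBlocks_multiply]
    rw [hab, Units.val_mul, Matrix.mul_assoc, hyb, ← Matrix.mul_assoc, hxa, Matrix.mul_assoc]
  | inv x _ hx =>
    obtain ⟨a, ha, hxa⟩ := hx
    refine ⟨a⁻¹, inv_mem ha, ?_⟩
    have haa : fromBlocks (a : Matrix ι ι ℚ) 0 0 (1 : Matrix κ κ ℚ) *
        fromBlocks ((a⁻¹ : GL ι ℚ) : Matrix ι ι ℚ) 0 0 1 = 1 := by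
      rw [fromBlocks_multiply]
      simp only [Units.mul_inv, Matrix.mul_zero, Matrix.zero_mul, Matrix.mul_one, add_zero,
        zero_add, fromBlocks_one]
    rw [Units.inv_mul_eq_iff_eq_mul, ← Matrix.mul_assoc, hxa, Matrix.mul_assoc, haa,
      Matrix.mul_one]


/-- If `C A_I = A_{JI}`, then conjugation by the block matrix `M = [[1,0],[C,1]]` turns every
Weyl reflection `S_i`, `i ∈ I`, into the block-diagonal matrix `diag(S_i^{(A_I)}, 1)`;
consequently it carries the linear action of `W_I(A)` on `ℚ^n` to the direct sum of the weight
action of `W(A_I)` on `ℚ^m` and the trivial action on `ℚ^{n-m}`. Here `n = m + k`,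
`I = {1,…,m}`, `J = {m+1,…,n}`, modelled by the index type `Fin m ⊕ Fin k`. -/
theorem conj_weylMatrix_blockDiagonal {m k : ℕ} (hm : 0 < m) (hk : 0 < k)
    (A : Matrix (Fin m ⊕ Fin k) (Fin m ⊕ Fin k) ℤ) (hA : IsCartanMatrix A)
    (C : Matrix (Fin k) (Fin m) ℚ)
    (hC : C * (A.map (fun z => (z : ℚ))).toBlocks₁₁ = (A.map (fun z => (z : ℚ))).toBlocks₂₁) :
    let M : Matrix (Fin m ⊕ Fin k) (Fin m ⊕ Fin k) ℚ := Matrix.fromBlocks 1 0 C 1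
    (∀ i : Fin m,
      M⁻¹ * weylMatrix A (Sum.inl i) * M =
        Matrix.fromBlocks (weylMatrix A.toBlocks₁₁ i) 0 0 1) ∧
    (∀ g ∈ weylGroup A (Set.range Sum.inl),
      ∃ h ∈ weylGroup A.toBlocks₁₁ (Set.univ : Set (Fin m)),
        M⁻¹ * (g : Matrix (Fin m ⊕ Fin k) (Fin m ⊕ Fin k) ℚ) * M =
          Matrix.fromBlocks (h : Matrix (Fin m) (Fin m) ℚ) 0 0 1) := by
  intro M
  have hM : IsUnit M.det := fromBlocks_one_zero_isUnit_det C
  refine ⟨fun i => ?_, fun g hg => ?_⟩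
  · rw [Matrix.mul_assoc, weylMatrix_inl_mul_fromBlocks A C hC i,
      Matrix.nonsing_inv_mul_cancel_left _ _ hM]
  · obtain ⟨h, hh, hrel⟩ := exists_weylGroup_mul_fromBlocks A C hC hg
    exact ⟨h, hh, by rw [Matrix.mul_assoc, hrel, Matrix.nonsing_inv_mul_cancel_left _ _ hM]⟩
end

section
/- (Proposition 5.1) Let A = (a_{ij}) be an n×n Cartan matrix, let 1 ≤ m < n, set I = {1,…,m} and J = {m+1,…,n}, and write A_I = (a_{kl})_{k,l∈I} (itself an m×m Cartan matrix) and A_{JI} = (a_{jl})_{j∈J, l∈I}. If the matrix equation X A_I = A_{JI} has a rational solution, then the ring of invariants P_I = ℚ[ω_1,…,ω_n]^{W_I(A)} is isomorphic as a ℚ-algebra to Q_I ⊗_ℚ ℚ[ω_{m+1},…,ω_n], where Q_I = ℚ[x_1,…,x_m]^{W(A_I)} is the ring of invariants of the Weyl group W(A_I) of the Cartan matrix A_I acting on its own weight polynomial ring ℚ[x_1,…,x_m] (by the same construction of Weyl reflections applied to A_I). -/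
set_option synthInstance.maxHeartbeats 1000000
set_option maxHeartbeats 1000000

/-- The action of a matrix `g` on the polynomial ring `ℚ[ω_1,…,ω_n]` by the `ℚ`-algebra
endomorphism extending its linear action on the span of the variables:
`ω_j ↦ ∑ₖ g_{kj} ω_k`. -/
noncomputable def matAct {ι : Type*} [Fintype ι] (g : Matrix ι ι ℚ) :
    MvPolynomial ι ℚ →ₐ[ℚ] MvPolynomial ι ℚ :=
  MvPolynomial.aeval (fun j => ∑ k, g k j • MvPolynomial.X k)

/-- `P_I = P^{W_I(A)}`, the fixed subalgebra of the polynomial ring `ℚ[ω_1,…,ω_n]` under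
the action of `W_I(A)`. -/
noncomputable def fixedAlg {ι : Type*} [Fintype ι] [DecidableEq ι] (A : Matrix ι ι ℤ)
    (I : Set ι) : Subalgebra ℚ (MvPolynomial ι ℚ) where
  carrier := {p | ∀ g ∈ weylGroup A I, matAct (g : Matrix ι ι ℚ) p = p}
  mul_mem' := fun hp hq g hg => by rw [map_mul, hp g hg, hq g hg]
  add_mem' := fun hp hq g hg => by rw [map_add, hp g hg, hq g hg]
  algebraMap_mem' := fun r g hg => by exact AlgHom.commutes _ r

theorem weylMatrix_mul_self {ι : Type*} [Fintype ι] [DecidableEq ι] {A : Matrix ι ι ℤ} {i : ι}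
    (hi : A i i = 2) : weylMatrix A i * weylMatrix A i = 1 := by
  have h : Matrix.of (fun k l => if l = i then (A k i : ℚ) else 0) *
      Matrix.of (fun k l => if l = i then (A k i : ℚ) else 0) =
      (2 : ℚ) • Matrix.of (fun k l => if l = i then (A k i : ℚ) else 0) := by
    ext k l
    by_cases hl : l = i <;> simp [Matrix.mul_apply, hl, hi, mul_comm]
  rw [weylMatrix]
  generalize Matrix.of (fun k l => if l = i then (A k i : ℚ) else 0) = N at h
  rw [sub_mul, mul_sub N, h, two_smul]
  simp

theorem matAct_one {ι : Type*} [Fintype ι] [DecidableEq ι] :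
    matAct (1 : Matrix ι ι ℚ) = AlgHom.id ℚ _ := by
  ext j : 1
  simp [matAct, Matrix.one_apply, ite_smul]

theorem matAct_mul {ι : Type*} [Fintype ι] (g h : Matrix ι ι ℚ) :
    matAct (g * h) = (matAct g).comp (matAct h) := by
  ext j : 1
  simp only [matAct, MvPolynomial.aeval_X, AlgHom.comp_apply, map_sum, map_smul,
    Matrix.mul_apply, Finset.sum_smul, Finset.smul_sum, smul_smul]
  rw [Finset.sum_comm]
  simp only [mul_comm]

theorem mem_fixedAlg_iff {ι : Type*} [Fintype ι] [DecidableEq ι] {A : Matrix ι ι ℤ} {I : Set ι}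
    (hA : ∀ i, A i i = 2) {p : MvPolynomial ι ℚ} :
    p ∈ fixedAlg A I ↔ ∀ i ∈ I, matAct (weylMatrix A i) p = p := by
  constructor
  · intro hp i hi
    exact hp ⟨weylMatrix A i, weylMatrix A i, weylMatrix_mul_self (hA i),
      weylMatrix_mul_self (hA i)⟩ (Subgroup.subset_closure ⟨i, hi, rfl⟩)
  · intro hp g hg
    induction hg using Subgroup.closure_induction with
    | mem g hg =>
      obtain ⟨i, hi, h⟩ := hg
      rw [h, hp i hi]
    | one => simp [matAct_one]
    | mul g h _ _ hg hh => rw [Units.val_mul, matAct_mul, AlgHom.comp_apply, hh, hg]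
    | inv g _ hg =>
      conv_lhs => rw [← hg]
      rw [← AlgHom.comp_apply, ← matAct_mul, ← Units.val_mul, inv_mul_cancel]
      simp [matAct_one]

/-- The automorphism of the polynomial ring in two blocks of variables which translates each
variable `x_l` of the first block by the linear form `∑ⱼ C_{jl} y_j` in the second block. -/
noncomputable def shearEquiv {σ τ : Type*} [Fintype τ] (C : Matrix τ σ ℚ) :
    MvPolynomial (σ ⊕ τ) ℚ ≃ₐ[ℚ] MvPolynomial (σ ⊕ τ) ℚ :=
  AlgEquiv.ofAlgHom
    (MvPolynomial.aeval (Sum.elim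
      (fun l => MvPolynomial.X (.inl l) + ∑ j, C j l • MvPolynomial.X (.inr j))
      (fun j => MvPolynomial.X (.inr j))))
    (MvPolynomial.aeval (Sum.elim
      (fun l => MvPolynomial.X (.inl l) - ∑ j, C j l • MvPolynomial.X (.inr j))
      (fun j => MvPolynomial.X (.inr j))))
    (by ext (l | j) : 1 <;> simp)
    (by ext (l | j) : 1 <;> simp)

/-- Polynomials in two blocks of variables as polynomials in the second block with coefficients
polynomials in the first block. -/
noncomputable def iterEquiv (σ τ : Type*) :
    MvPolynomial (σ ⊕ τ) ℚ ≃ₐ[ℚ] MvPolynomial τ (MvPolynomial σ ℚ) :=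
  (MvPolynomial.renameEquiv ℚ (Equiv.sumComm σ τ)).trans (MvPolynomial.sumAlgEquiv ℚ τ σ)

@[simp] theorem shearEquiv_X_inl {σ τ : Type*} [Fintype τ] (C : Matrix τ σ ℚ) (l : σ) :
    shearEquiv C (MvPolynomial.X (.inl l)) =
      MvPolynomial.X (.inl l) + ∑ j, C j l • MvPolynomial.X (.inr j) := by
  simp [shearEquiv]

@[simp] theorem shearEquiv_X_inr {σ τ : Type*} [Fintype τ] (C : Matrix τ σ ℚ) (j : τ) :
    shearEquiv C (MvPolynomial.X (.inr j)) = MvPolynomial.X (.inr j) := by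
  simp [shearEquiv]

@[simp] theorem iterEquiv_X_inl {σ τ : Type*} (l : σ) :
    iterEquiv σ τ (MvPolynomial.X (.inl l)) = MvPolynomial.C (MvPolynomial.X l) := by
  simp [iterEquiv]

@[simp] theorem iterEquiv_X_inr {σ τ : Type*} (j : τ) :
    iterEquiv σ τ (MvPolynomial.X (.inr j)) = MvPolynomial.X j := by
  simp [iterEquiv]

theorem iterEquiv_symm_C_X {σ τ : Type*} (l : σ) :
    (iterEquiv σ τ).symm (MvPolynomial.C (MvPolynomial.X l)) = MvPolynomial.X (.inl l) := by
  rw [AlgEquiv.symm_apply_eq, iterEquiv_X_inl]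

theorem iterEquiv_symm_X {σ τ : Type*} (j : τ) :
    (iterEquiv σ τ).symm (MvPolynomial.X j) = MvPolynomial.X (.inr j) := by
  rw [AlgEquiv.symm_apply_eq, iterEquiv_X_inr]

theorem matAct_weylMatrix_X {ι : Type*} [Fintype ι] [DecidableEq ι] (A : Matrix ι ι ℤ) (i j : ι) :
    matAct (weylMatrix A i) (MvPolynomial.X j) =
      MvPolynomial.X j - if j = i then ∑ k, (A k i : ℚ) • MvPolynomial.X k else 0 := by
  by_cases h : j = i <;>
    simp [matAct, weylMatrix, h, sub_smul, Finset.sum_sub_distrib, Matrix.one_apply, ite_smul]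

theorem matAct_weylMatrix_comp_shearEquiv {σ τ : Type*} [Fintype σ] [DecidableEq σ] [Fintype τ]
    [DecidableEq τ] {A : Matrix (σ ⊕ τ) (σ ⊕ τ) ℤ} {C : Matrix τ σ ℚ}
    (hC : C * (A.map (fun z => (z : ℚ))).toBlocks₁₁ = (A.map (fun z => (z : ℚ))).toBlocks₂₁)
    (i : σ) :
    (matAct (weylMatrix A (.inl i))).comp (shearEquiv C : _ →ₐ[ℚ] _) =
      ((shearEquiv C).toAlgHom.comp (iterEquiv σ τ).symm.toAlgHom).comp
        ((MvPolynomial.mapAlgHom (matAct (weylMatrix A.toBlocks₁₁ i))).comp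
          (iterEquiv σ τ).toAlgHom) := by
  have hC' : ∀ j, (A (.inr j) (.inl i) : ℚ) = ∑ l, C j l * (A (.inl l) (.inl i) : ℚ) := by
    intro j
    simpa [Matrix.mul_apply, Matrix.toBlocks₁₁, Matrix.toBlocks₂₁] using
      (congrFun (congrFun hC j) i).symm
  have hs : ∀ (c : ℚ) (l : σ), (iterEquiv σ τ).symm (MvPolynomial.C (c • MvPolynomial.X l)) =
      c • MvPolynomial.X (.inl l) := by
    intro c l
    rw [AlgEquiv.symm_apply_eq, map_smul (iterEquiv σ τ), iterEquiv_X_inl,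
      MvPolynomial.smul_eq_C_mul, map_mul, Algebra.smul_def]
    rfl
  ext (l | j) : 1
  · by_cases h : l = i
    · subst h
      simp [matAct_weylMatrix_X, iterEquiv_symm_C_X, hs, hC', Finset.sum_smul, Finset.smul_sum,
        Finset.sum_add_distrib, smul_smul, Matrix.toBlocks₁₁, mul_comm]
      rw [Finset.sum_comm]
      ring
    · simp [matAct_weylMatrix_X, iterEquiv_symm_C_X, h]
  · simp [matAct_weylMatrix_X, iterEquiv_symm_X]

theorem mem_range_mapAlgHom_val_iff {R S τ : Type*} [CommRing R] [CommRing S] [Algebra R S]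
    {B : Subalgebra R S} {q : MvPolynomial τ S} :
    q ∈ (MvPolynomial.mapAlgHom (σ := τ) B.val).range ↔ ∀ d, q.coeff d ∈ B := by
  constructor
  · rintro ⟨r, rfl⟩ d
    simp [MvPolynomial.coeff_map]
  · intro hq
    refine MvPolynomial.mem_range_map_iff_coeffs_subset (f := B.val.toRingHom).mpr fun c hc => ?_
    obtain ⟨d, _, rfl⟩ := MvPolynomial.mem_coeffs_iff.mp hc
    exact ⟨⟨_, hq d⟩, rfl⟩

theorem mem_range_map_val_fixedAlg_iff {σ τ : Type*} [Fintype σ] [DecidableEq σ]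
    {A : Matrix σ σ ℤ} (hA : ∀ i, A i i = 2) {q : MvPolynomial τ (MvPolynomial σ ℚ)} :
    q ∈ (MvPolynomial.mapAlgHom (σ := τ) (fixedAlg A Set.univ).val).range ↔
      ∀ i, MvPolynomial.mapAlgHom (matAct (weylMatrix A i)) q = q := by
  have h (i : σ) : MvPolynomial.mapAlgHom (matAct (weylMatrix A i)) q = q ↔
      ∀ d, matAct (weylMatrix A i) (q.coeff d) = q.coeff d := by
    rw [MvPolynomial.ext_iff]
    refine forall_congr' fun d => ?_
    rw [MvPolynomial.mapAlgHom_apply, MvPolynomial.coeff_map]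
    rfl
  rw [mem_range_mapAlgHom_val_iff]
  simp only [h, mem_fixedAlg_iff hA, Set.mem_univ, true_implies]
  exact forall_comm

theorem mem_fixedAlg_range_inl_iff {σ τ : Type*} [Fintype σ] [DecidableEq σ] [Fintype τ]
    [DecidableEq τ] {A : Matrix (σ ⊕ τ) (σ ⊕ τ) ℤ} (hA : ∀ i, A i i = 2) {C : Matrix τ σ ℚ}
    (hC : C * (A.map (fun z => (z : ℚ))).toBlocks₁₁ = (A.map (fun z => (z : ℚ))).toBlocks₂₁)
    {q : MvPolynomial τ (MvPolynomial σ ℚ)} :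
    shearEquiv C ((iterEquiv σ τ).symm q) ∈ fixedAlg A (Set.range Sum.inl) ↔
      q ∈ (MvPolynomial.mapAlgHom (σ := τ) (fixedAlg A.toBlocks₁₁ Set.univ).val).range := by
  rw [mem_fixedAlg_iff hA, mem_range_map_val_fixedAlg_iff fun i => hA (.inl i),
    Set.forall_mem_range]
  refine forall_congr' fun i => ?_
  have h := DFunLike.congr_fun (matAct_weylMatrix_comp_shearEquiv hC i) ((iterEquiv σ τ).symm q)
  simp only [AlgHom.comp_apply, AlgEquiv.toAlgHom_apply,
    AlgEquiv.apply_symm_apply] at h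
  rw [h, EmbeddingLike.apply_eq_iff_eq, EmbeddingLike.apply_eq_iff_eq]

/-- (Proposition 5.1) If the matrix equation `X A_I = A_{JI}` has a rational solution, then
the ring of invariants `P_I = ℚ[ω_1,…,ω_n]^{W_I(A)}` is isomorphic as a `ℚ`-algebra to
`Q_I ⊗_ℚ ℚ[ω_{m+1},…,ω_n]`, where `Q_I = ℚ[x_1,…,x_m]^{W(A_I)}`. Here `n = m + k`,
`I = {1,…,m}`, `J = {m+1,…,n}`, modelled by the index type `Fin m ⊕ Fin k`. -/
theorem fixedAlg_iso_tensor_of_solution {m k : ℕ} (hm : 0 < m) (hk : 0 < k)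
    (A : Matrix (Fin m ⊕ Fin k) (Fin m ⊕ Fin k) ℤ) (hA : IsCartanMatrix A)
    (hC : ∃ C : Matrix (Fin k) (Fin m) ℚ,
      C * (A.map (fun z => (z : ℚ))).toBlocks₁₁ = (A.map (fun z => (z : ℚ))).toBlocks₂₁) :
    Nonempty ((fixedAlg A (Set.range Sum.inl)) ≃ₐ[ℚ]
      TensorProduct ℚ (fixedAlg A.toBlocks₁₁ (Set.univ : Set (Fin m)))
        (MvPolynomial (Fin k) ℚ)) := by
  obtain ⟨C, hC⟩ := hC
  set Q := fixedAlg A.toBlocks₁₁ (Set.univ : Set (Fin m))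
  let e : MvPolynomial (Fin k) (MvPolynomial (Fin m) ℚ) ≃ₐ[ℚ] MvPolynomial (Fin m ⊕ Fin k) ℚ :=
    (iterEquiv (Fin m) (Fin k)).symm.trans (shearEquiv C)
  let f : MvPolynomial (Fin k) Q →ₐ[ℚ] MvPolynomial (Fin m ⊕ Fin k) ℚ :=
    (e : _ →ₐ[ℚ] _).comp (MvPolynomial.mapAlgHom Q.val)
  have hf : Function.Injective f :=
    e.injective.comp (MvPolynomial.map_injective _ Subtype.val_injective)
  have hr : f.range = fixedAlg A (Set.range Sum.inl) := by
    ext p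
    obtain ⟨q, rfl⟩ := e.surjective p
    refine Iff.trans ?_ (mem_fixedAlg_range_inl_iff hA.1 hC).symm
    constructor
    · rintro ⟨r, hr⟩
      exact ⟨r, e.injective hr⟩
    · rintro ⟨r, hr⟩
      exact ⟨r, congrArg e hr⟩
  exact ⟨((Subalgebra.equivOfEq _ _ hr.symm).trans (AlgEquiv.ofInjective f hf).symm).trans
    ((MvPolynomial.algebraTensorAlgEquiv ℚ Q).restrictScalars ℚ).symm⟩
end

section
/- Let V be a ℚ-vector space, S a set, and P a family of subspaces of V indexed by subsets of S with P(I ∪ J) = P(I) ∩ P(J) for all I, J ⊆ S. Let I_1, I_2, I_3 ⊆ S. Then the first cohomology H^1 = ker δ_1 / im δ_0 of the Čech complex associated to I_1, I_2, I_3 is isomorphic as a ℚ-vector space to the direct sum [P(I_1∩I_2) ∩ (P(I_1∩I_3) + P(I_2∩I_3))]/(P(I_1) + P(I_2)) ⊕ P((I_1∪I_2)∩I_3)/(P(I_1∪I_2) + P(I_3)). (In each summand the denominator is a subspace of the numerator.) -/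
open Submodule

section

variable (V : Type*) [AddCommGroup V] [Module ℚ V]

/-- The Čech differential `δ₀ : P(I₁) ⊕ P(I₂) ⊕ P(I₃) → P(I₁∩I₂) ⊕ P(I₁∩I₃) ⊕ P(I₂∩I₃)`
for three subsets, as the ambient linear map `(v₁,v₂,v₃) ↦ (v₁−v₂, v₁−v₃, v₂−v₃)`. -/
def cechD0₃ : (V × V × V) →ₗ[ℚ] (V × V × V) :=
  ((LinearMap.fst ℚ V (V × V)) -
      (LinearMap.fst ℚ V V).comp (LinearMap.snd ℚ V (V × V))).prod
    (((LinearMap.fst ℚ V (V × V)) -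
        (LinearMap.snd ℚ V V).comp (LinearMap.snd ℚ V (V × V))).prod
      ((LinearMap.fst ℚ V V).comp (LinearMap.snd ℚ V (V × V)) -
        (LinearMap.snd ℚ V V).comp (LinearMap.snd ℚ V (V × V))))

/-- The Čech differential `δ₁ : P(I₁∩I₂) ⊕ P(I₁∩I₃) ⊕ P(I₂∩I₃) → P(I₁∩I₂∩I₃)` for three
subsets, as the ambient linear map `(v₁₂,v₁₃,v₂₃) ↦ v₁₂ − v₁₃ + v₂₃`. -/
def cechD1₃ : (V × V × V) →ₗ[ℚ] V :=
  (LinearMap.fst ℚ V (V × V)) -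
    (LinearMap.fst ℚ V V).comp (LinearMap.snd ℚ V (V × V)) +
    (LinearMap.snd ℚ V V).comp (LinearMap.snd ℚ V (V × V))

/-- The middle term of a short exact sequence of vector spaces is isomorphic to the product of
the outer terms. -/
theorem nonempty_linearEquiv_prod_of_exact {K M N Q : Type*} [DivisionRing K]
    [AddCommGroup M] [Module K M] [AddCommGroup N] [Module K N] [AddCommGroup Q] [Module K Q]
    {f : M →ₗ[K] N} {g : N →ₗ[K] Q} (h : Function.Exact f g) (hf : Function.Injective f)
    (hg : Function.Surjective g) : Nonempty (N ≃ₗ[K] M × Q) := by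
  obtain ⟨l, hl⟩ := g.exists_rightInverse_of_surjective (LinearMap.range_eq_top.2 hg)
  exact ⟨(h.splitSurjectiveEquiv hf ⟨l, hl⟩).1⟩

/-- For three subsets `I₁, I₂, I₃ ⊆ S`, the first Čech cohomology
`H¹ = ker δ₁ / im δ₀` is isomorphic to
`[P(I₁∩I₂) ∩ (P(I₁∩I₃) + P(I₂∩I₃))]/(P(I₁)+P(I₂)) ⊕ P((I₁∪I₂)∩I₃)/(P(I₁∪I₂)+P(I₃))`;
in each summand the denominator is a subspace of the numerator. -/
theorem cech3_H1 {S : Type*} (P : Set S → Submodule ℚ V)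
    (hP : ∀ I J : Set S, P (I ∪ J) = P I ⊓ P J) (I₁ I₂ I₃ : Set S) :
    let Z1 : Submodule ℚ (V × V × V) :=
      (P (I₁ ∩ I₂)).prod ((P (I₁ ∩ I₃)).prod (P (I₂ ∩ I₃))) ⊓ LinearMap.ker (cechD1₃ V)
    let B1 : Submodule ℚ (V × V × V) :=
      Submodule.map (cechD0₃ V) ((P I₁).prod ((P I₂).prod (P I₃)))
    let N1 : Submodule ℚ V := P (I₁ ∩ I₂) ⊓ (P (I₁ ∩ I₃) ⊔ P (I₂ ∩ I₃))
    let N2 : Submodule ℚ V := P ((I₁ ∪ I₂) ∩ I₃)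
    (P I₁ ⊔ P I₂ ≤ N1) ∧ (P (I₁ ∪ I₂) ⊔ P I₃ ≤ N2) ∧
    Nonempty ((Z1 ⧸ B1.comap Z1.subtype) ≃ₗ[ℚ]
      ((N1 ⧸ (P I₁ ⊔ P I₂).comap N1.subtype) ×
        (N2 ⧸ (P (I₁ ∪ I₂) ⊔ P I₃).comap N2.subtype))) := by
  intro Z1 B1 N1 N2
  have anti : ∀ {I J : Set S}, I ⊆ J → P J ≤ P I := fun {I J} h => by
    rw [← Set.union_eq_self_of_subset_left h, hP]
    exact inf_le_left
  have h1 : P I₁ ⊔ P I₂ ≤ N1 :=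
    le_inf (sup_le (anti Set.inter_subset_left) (anti Set.inter_subset_right))
      (sup_le_sup (anti Set.inter_subset_left) (anti Set.inter_subset_left))
  have h2 : P (I₁ ∪ I₂) ⊔ P I₃ ≤ N2 :=
    sup_le (anti Set.inter_subset_left) (anti Set.inter_subset_right)
  have hN2 : ∀ x : V, x ∈ N2 ↔ x ∈ P (I₁ ∩ I₃) ∧ x ∈ P (I₂ ∩ I₃) := by
    simp only [N2, Set.union_inter_distrib_right, hP, Submodule.mem_inf, implies_true]
  have hZ1 : ∀ a b c : V, (a, b, c) ∈ Z1 ↔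
      (a ∈ P (I₁ ∩ I₂) ∧ b ∈ P (I₁ ∩ I₃) ∧ c ∈ P (I₂ ∩ I₃)) ∧ a - b + c = 0 := by
    intro a b c
    simp [Z1, cechD1₃]
  have hB1 : ∀ a b c : V, (a, b, c) ∈ B1 ↔ ∃ x ∈ P I₁, ∃ y ∈ P I₂, ∃ z ∈ P I₃,
      x - y = a ∧ x - z = b ∧ y - z = c := by
    intro a b c
    simp only [B1, Submodule.mem_map, Prod.exists, Submodule.mem_prod, cechD0₃]
    constructor
    · rintro ⟨x, y, z, ⟨hx, hy, hz⟩, h⟩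
      simp only [LinearMap.prod_apply, Function.prod, Prod.mk.injEq] at h
      exact ⟨x, hx, y, hy, z, hz, h⟩
    · rintro ⟨x, hx, y, hy, z, hz, rfl, rfl, rfl⟩
      exact ⟨x, y, z, ⟨hx, hy, hz⟩, rfl⟩
  refine ⟨h1, h2, ?_⟩
  let i : N2 →ₗ[ℚ] Z1 :=
    (((0 : V →ₗ[ℚ] V).prod (LinearMap.id.prod LinearMap.id)).comp N2.subtype).codRestrict Z1
      fun x => (hZ1 0 x x).2 ⟨⟨zero_mem _, (hN2 x).1 x.2⟩, by simp⟩
  let p : Z1 →ₗ[ℚ] N1 :=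
    ((LinearMap.fst ℚ V (V × V)).comp Z1.subtype).codRestrict N1 (by
      rintro ⟨⟨a, b, c⟩, h⟩
      obtain ⟨⟨ha, hb, hc⟩, h0⟩ := (hZ1 a b c).1 h
      have : a = b - c := by rw [← sub_eq_zero, ← h0]; abel
      exact ⟨ha, by simpa [this] using sub_mem (mem_sup_left hb) (mem_sup_right hc)⟩)
  have hi : (P (I₁ ∪ I₂) ⊔ P I₃).comap N2.subtype ≤ (B1.comap Z1.subtype).comap i := by
    rintro ⟨x, hx⟩ h
    obtain ⟨y, hy, z, hz, rfl⟩ := mem_sup.1 h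
    rw [hP] at hy
    exact (hB1 _ _ _).2 ⟨y, hy.1, y, hy.2, -z, neg_mem hz, by simp, by simp, by simp⟩
  have hp : B1.comap Z1.subtype ≤ ((P I₁ ⊔ P I₂).comap N1.subtype).comap p := by
    rintro ⟨⟨a, b, c⟩, h⟩ h'
    obtain ⟨x, hx, y, hy, z, hz, rfl, rfl, rfl⟩ := (hB1 a b c).1 h'
    exact sub_mem (mem_sup_left hx) (mem_sup_right hy)
  let i' := mapQ _ _ i hi
  let p' := mapQ _ _ p hp
  have hi' : Function.Injective i' := by
    rw [← LinearMap.ker_eq_bot, LinearMap.ker_eq_bot']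
    intro q hq
    obtain ⟨⟨x, hx⟩, rfl⟩ := Submodule.Quotient.mk_surjective _ q
    have hq' := (Submodule.Quotient.mk_eq_zero _).1 hq
    obtain ⟨y, hy, y', hy', z, hz, h, rfl, -⟩ := (hB1 0 x x).1 hq'
    obtain rfl := sub_eq_zero.1 h
    refine (Submodule.Quotient.mk_eq_zero _).2 (sub_mem (mem_sup_left ?_) (mem_sup_right hz))
    rw [hP]
    exact ⟨hy, hy'⟩
  have hp' : Function.Surjective p' := by
    intro q
    obtain ⟨⟨a, ha, ha'⟩, rfl⟩ := Submodule.Quotient.mk_surjective _ q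
    obtain ⟨b, hb, c, hc, rfl⟩ := mem_sup.1 ha'
    exact ⟨Submodule.Quotient.mk ⟨(b + c, b, -c),
      (hZ1 _ _ _).2 ⟨⟨ha, hb, neg_mem hc⟩, by abel⟩⟩, rfl⟩
  have hex : Function.Exact i' p' := by
    intro q
    constructor
    · obtain ⟨⟨⟨a, b, c⟩, h⟩, rfl⟩ := Submodule.Quotient.mk_surjective _ q
      intro hq
      obtain ⟨⟨-, hb, hc⟩, h0⟩ := (hZ1 a b c).1 h
      have ha : p ⟨(a, b, c), h⟩ ∈ (P I₁ ⊔ P I₂).comap N1.subtype :=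
        (Submodule.Quotient.mk_eq_zero _).1 hq
      replace ha : a ∈ P I₁ ⊔ P I₂ := ha
      obtain ⟨x, hx, y, hy, rfl⟩ := mem_sup.1 ha
      have hbc : b - x = c + y := by rw [← sub_eq_zero, ← neg_eq_zero, ← h0]; abel
      have hmem : b - x ∈ N2 := (hN2 _).2 ⟨sub_mem hb (anti Set.inter_subset_left hx), by
        rw [hbc]
        exact add_mem hc (anti Set.inter_subset_left hy)⟩
      refine ⟨Submodule.Quotient.mk ⟨b - x, hmem⟩, ?_⟩
      refine (Submodule.Quotient.eq _).2 ((hB1 (0 - (x + y)) (b - x - b) (b - x - c)).2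
        ⟨-x, neg_mem hx, y, hy, 0, zero_mem _, by abel, by abel, ?_⟩)
      rw [hbc]
      abel
    · rintro ⟨r, rfl⟩
      obtain ⟨x, rfl⟩ := Submodule.Quotient.mk_surjective _ r
      exact (Submodule.Quotient.mk_eq_zero _).2 (zero_mem (P I₁ ⊔ P I₂))
  obtain ⟨e⟩ := nonempty_linearEquiv_prod_of_exact hex hi' hp'
  exact ⟨e.trans (LinearEquiv.prodComm ℚ _ _)⟩

end
end

section
/- Let V be a ℚ-vector space, S a set, and P a family of subspaces of V indexed by subsets of S with P(I ∪ J) = P(I) ∩ P(J) for all I, J ⊆ S. Let I_1, I_2, I_3, I_4 ⊆ S and consider the Čech complex associated to them. Every cocycle (v_{123}, v_{124}, v_{134}, v_{234}) ∈ ker δ_2 has v_{123} ∈ P(I_1∩I_2∩I_3) ∩ (P(I_1∩I_2∩I_4) + P(I_1∩I_3∩I_4) + P(I_2∩I_3∩I_4)), and the assignment sending the class of such a cocycle to the class of v_{123} gives a well-defined surjective ℚ-linear map ψ_1 : H^2 → [P(I_1∩I_2∩I_3) ∩ (P(I_1∩I_2∩I_4) + P(I_1∩I_3∩I_4) + P(I_2∩I_3∩I_4))]/(P(I_1∩I_2)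 + P(I_1∩I_3) + P(I_2∩I_3)), where H^2 = ker δ_2 / im δ_1. -/
open Submodule

section

variable (V : Type*) [AddCommGroup V] [Module ℚ V]

/-- Projection onto the `i`-th coordinate of a 4-tuple. -/
def pr4 (i : Fin 4) : (Fin 4 → V) →ₗ[ℚ] V := LinearMap.proj i

/-- Projection onto the `i`-th coordinate of a 6-tuple. -/
def pr6 (i : Fin 6) : (Fin 6 → V) →ₗ[ℚ] V := LinearMap.proj i

/-- The Čech differential `δ₀` for four subsets, as the ambient linear map
`(v₁,v₂,v₃,v₄) ↦ (v₁−v₂, v₁−v₃, v₁−v₄, v₂−v₃, v₂−v₄, v₃−v₄)`; 1-cochains are indexed in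
the order `(12, 13, 14, 23, 24, 34)`. -/
def cechD0₄ : (Fin 4 → V) →ₗ[ℚ] (Fin 6 → V) :=
  LinearMap.pi ![pr4 V 0 - pr4 V 1, pr4 V 0 - pr4 V 2, pr4 V 0 - pr4 V 3,
    pr4 V 1 - pr4 V 2, pr4 V 1 - pr4 V 3, pr4 V 2 - pr4 V 3]

/-- The Čech differential `δ₁` for four subsets, as the ambient linear map
`(δ₁ v)_{ijk} = v_{ij} − v_{ik} + v_{jk}`; 1-cochains are indexed in the order
`(12, 13, 14, 23, 24, 34)` and 2-cochains in the order `(123, 124, 134, 234)`. -/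
def cechD1₄ : (Fin 6 → V) →ₗ[ℚ] (Fin 4 → V) :=
  LinearMap.pi ![pr6 V 0 - pr6 V 1 + pr6 V 3, pr6 V 0 - pr6 V 2 + pr6 V 4,
    pr6 V 1 - pr6 V 2 + pr6 V 5, pr6 V 3 - pr6 V 4 + pr6 V 5]

/-- The Čech differential `δ₂` for four subsets, as the ambient linear map
`(v₁₂₃, v₁₂₄, v₁₃₄, v₂₃₄) ↦ v₁₂₃ − v₁₂₄ + v₁₃₄ − v₂₃₄`. -/
def cechD2₄ : (Fin 4 → V) →ₗ[ℚ] V := pr4 V 0 - pr4 V 1 + pr4 V 2 - pr4 V 3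

/-- For four subsets `I₁, I₂, I₃, I₄ ⊆ S`, every Čech 2-cocycle `(v₁₂₃, v₁₂₄, v₁₃₄, v₂₃₄)`
has `v₁₂₃ ∈ P(I₁∩I₂∩I₃) ∩ (P(I₁∩I₂∩I₄) + P(I₁∩I₃∩I₄) + P(I₂∩I₃∩I₄))`, and sending the
class of a cocycle to the class of `v₁₂₃` gives a well-defined surjective `ℚ`-linear map
`ψ₁ : H² → [P(I₁∩I₂∩I₃) ∩ (P(I₁∩I₂∩I₄) + P(I₁∩I₃∩I₄) + P(I₂∩I₃∩I₄))]/(P(I₁∩I₂) + P(I₁∩I₃) + P(I₂∩I₃))`. -/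
theorem cech4_psi1 {S : Type*} (P : Set S → Submodule ℚ V)
    (hP : ∀ I J : Set S, P (I ∪ J) = P I ⊓ P J) (I₁ I₂ I₃ I₄ : Set S) :
    let C1 : Submodule ℚ (Fin 6 → V) := Submodule.pi Set.univ
      ![P (I₁ ∩ I₂), P (I₁ ∩ I₃), P (I₁ ∩ I₄), P (I₂ ∩ I₃), P (I₂ ∩ I₄), P (I₃ ∩ I₄)]
    let C2 : Submodule ℚ (Fin 4 → V) := Submodule.pi Set.univ
      ![P (I₁ ∩ I₂ ∩ I₃), P (I₁ ∩ I₂ ∩ I₄), P (I₁ ∩ I₃ ∩ I₄), P (I₂ ∩ I₃ ∩ I₄)]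
    let Z2 : Submodule ℚ (Fin 4 → V) := C2 ⊓ LinearMap.ker (cechD2₄ V)
    let B2 : Submodule ℚ (Fin 4 → V) := Submodule.map (cechD1₄ V) C1
    let N : Submodule ℚ V :=
      P (I₁ ∩ I₂ ∩ I₃) ⊓ (P (I₁ ∩ I₂ ∩ I₄) ⊔ P (I₁ ∩ I₃ ∩ I₄) ⊔ P (I₂ ∩ I₃ ∩ I₄))
    (∀ v ∈ Z2, v 0 ∈ N) ∧
    ∃ ψ : (Z2 ⧸ B2.comap Z2.subtype) →ₗ[ℚ]
        (N ⧸ (P (I₁ ∩ I₂) ⊔ P (I₁ ∩ I₃) ⊔ P (I₂ ∩ I₃)).comap N.subtype),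
      Function.Surjective ψ ∧
      ∀ (v : Fin 4 → V) (hv : v ∈ Z2) (h0 : v 0 ∈ N),
        ψ (Submodule.Quotient.mk ⟨v, hv⟩) = Submodule.Quotient.mk ⟨v 0, h0⟩ := by
  intro C1 C2 Z2 B2 N
  have mem_Z2 (v : Fin 4 → V) : v ∈ Z2 ↔ (v 0 ∈ P (I₁ ∩ I₂ ∩ I₃) ∧ v 1 ∈ P (I₁ ∩ I₂ ∩ I₄) ∧
      v 2 ∈ P (I₁ ∩ I₃ ∩ I₄) ∧ v 3 ∈ P (I₂ ∩ I₃ ∩ I₄)) ∧ v 0 - v 1 + v 2 - v 3 = 0 := by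
    simp [Z2, C2, Submodule.mem_pi, Fin.forall_fin_succ, cechD2₄, pr4]
  have hN : ∀ v ∈ Z2, v 0 ∈ N := by
    intro v hv
    obtain ⟨⟨h0, h1, h2, h3⟩, h⟩ := (mem_Z2 v).1 hv
    refine ⟨h0, ?_⟩
    have e : v 0 = v 1 + -v 2 + v 3 := by
      rw [← sub_eq_zero, ← h]
      abel
    rw [e]
    exact add_mem_sup (add_mem_sup h1 (neg_mem h2)) h3
  refine ⟨hN, ?_⟩
  let f : Z2 →ₗ[ℚ] N :=
    ((LinearMap.proj 0 : (Fin 4 → V) →ₗ[ℚ] V).comp Z2.subtype).codRestrict N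
      fun v => hN v.1 v.2
  have hf : B2.comap Z2.subtype ≤
      ((P (I₁ ∩ I₂) ⊔ P (I₁ ∩ I₃) ⊔ P (I₂ ∩ I₃)).comap N.subtype).comap f := by
    rintro ⟨v, hv⟩ ⟨a, ha, rfl⟩
    have ha' : ∀ i, _ := fun i => ha i (Set.mem_univ i)
    change cechD1₄ V a 0 ∈ P (I₁ ∩ I₂) ⊔ P (I₁ ∩ I₃) ⊔ P (I₂ ∩ I₃)
    have e : cechD1₄ V a 0 = a 0 + -a 1 + a 3 := by
      simp [cechD1₄, pr6, sub_eq_add_neg]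
    rw [e]
    exact add_mem_sup (add_mem_sup (ha' 0) (neg_mem (ha' 1))) (ha' 3)
  refine ⟨Submodule.mapQ _ _ f hf, ?_, fun v hv h0 => rfl⟩
  intro y
  obtain ⟨⟨x, hx0, hx⟩, rfl⟩ := Submodule.Quotient.mk_surjective _ y
  obtain ⟨w, hw, d, hd, rfl⟩ := Submodule.mem_sup.1 hx
  obtain ⟨b, hb, c, hc, rfl⟩ := Submodule.mem_sup.1 hw
  have hv : ![b + c + d, b, -c, d] ∈ Z2 :=
    (mem_Z2 _).2 ⟨⟨hx0, hb, neg_mem hc, hd⟩, by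
      change b + c + d - b + -c - d = 0
      abel⟩
  exact ⟨Submodule.Quotient.mk ⟨_, hv⟩, rfl⟩


end
end
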